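/- Let (B,W) be a polygonal coloring of the plane with boundary ∂ satisfying condition (C3). Let u₁ and u₂ be two distinct boundary segments sharing a common endpoint X, and let d₁ and d₂ be the unit vectors at X pointing from X into u₁ and into u₂, respectively. Then the angle between d₁ and d₂ is greater than 2π/3. -/

import Mathlib

open scoped RealInnerProductSpace

noncomputable section

/-- `l` is an (affine) line in the plane: a nonempty one-dimensional affine subspace. -/
def IsLine (l : AffineSubspace ℝ (EuclideanSpace ℝ (Fin 2))) : Prop :=
  (l : Set (EuclideanSpace ℝ (Fin 2))).Nonempty ∧ Module.finrank ℝ l.direction = 1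

/-- A boundary segment: a closed convex subset of some affine line, containing
more than one point (it may be a segment, a ray, or a full line). -/
def IsSeg (s : Set (EuclideanSpace ℝ (Fin 2))) : Prop :=
  IsClosed s ∧ Convex ℝ s ∧ s.Nontrivial ∧
    ∃ l : AffineSubspace ℝ (EuclideanSpace ℝ (Fin 2)), IsLine l ∧ s ⊆ (l : Set _)

/-- `x` is an endpoint of the segment `s`: a point of `s` not in its relative
(intrinsic) interior. -/
def IsEndpoint (x : EuclideanSpace ℝ (Fin 2)) (s : Set (EuclideanSpace ℝ (Fin 2))) : Prop :=
  x ∈ s ∧ x ∉ intrinsicInterior ℝ s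

/-- The coloring `(B, Bᶜ)` is polygonal, with set of boundary segments `S`. -/
structure IsPolygonal (B : Set (EuclideanSpace ℝ (Fin 2)))
    (S : Set (Set (EuclideanSpace ℝ (Fin 2)))) : Prop where
  /-- The black points lie in the closure of the black interior. -/
  black_sub : B ⊆ closure (interior B)
  /-- The white points lie in the closure of the white interior. -/
  white_sub : Bᶜ ⊆ closure (interior Bᶜ)
  /-- Every member of `S` is a boundary segment. -/
  seg : ∀ s ∈ S, IsSeg s
  /-- The boundary of the coloring is the union of the boundary segments. -/
  boundary : frontier B = ⋃₀ S
  /-- Two distinct boundary segments meet in at most one point. -/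
  inter_subsingleton : ∀ s ∈ S, ∀ t ∈ S, s ≠ t → (s ∩ t).Subsingleton
  /-- A common point of two distinct boundary segments is an endpoint of both. -/
  inter_endpoint : ∀ s ∈ S, ∀ t ∈ S, s ≠ t → ∀ x ∈ s ∩ t, IsEndpoint x s ∧ IsEndpoint x t
  /-- No two distinct boundary segments sharing a common point lie on a common line. -/
  no_common_line : ∀ s ∈ S, ∀ t ∈ S, s ≠ t → (s ∩ t).Nonempty →
      ¬∃ l : AffineSubspace ℝ (EuclideanSpace ℝ (Fin 2)),
        IsLine l ∧ s ⊆ (l : Set _) ∧ t ⊆ (l : Set _)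
  /-- Every bounded region meets only finitely many boundary segments. -/
  loc_finite : ∀ R : Set (EuclideanSpace ℝ (Fin 2)), Bornology.IsBounded R →
      {s ∈ S | (s ∩ R).Nonempty}.Finite

/-- Condition (C3): every monochromatic unit triangle has a vertex on the boundary. -/
def C3 (B : Set (EuclideanSpace ℝ (Fin 2))) : Prop :=
  ∀ X Y Z : EuclideanSpace ℝ (Fin 2),
    dist X Y = 1 → dist Y Z = 1 → dist Z X = 1 →
    ((X ∈ B ∧ Y ∈ B ∧ Z ∈ B) ∨ (X ∉ B ∧ Y ∉ B ∧ Z ∉ B)) →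
    X ∈ frontier B ∨ Y ∈ frontier B ∨ Z ∈ frontier B

/-- `x` is a boundary vertex: an endpoint of some boundary segment. -/
def IsVertex (S : Set (Set (EuclideanSpace ℝ (Fin 2)))) (x : EuclideanSpace ℝ (Fin 2)) : Prop :=
  ∃ s ∈ S, IsEndpoint x s

/-- A boundary point `A` is feasible if it is not a boundary vertex and the unit
circle centered at `A` contains no boundary vertex. -/
def Feasible (B : Set (EuclideanSpace ℝ (Fin 2))) (S : Set (Set (EuclideanSpace ℝ (Fin 2))))
    (A : EuclideanSpace ℝ (Fin 2)) : Prop :=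
  A ∈ frontier B ∧ ¬IsVertex S A ∧ ∀ P ∈ Metric.sphere A 1, ¬IsVertex S P

/-- Two segments are parallel: any lines containing them have the same direction. -/
def SegParallel (s t : Set (EuclideanSpace ℝ (Fin 2))) : Prop :=
  ∀ l₁ l₂ : AffineSubspace ℝ (EuclideanSpace ℝ (Fin 2)),
    IsLine l₁ → IsLine l₂ → s ⊆ (l₁ : Set _) → t ⊆ (l₂ : Set _) →
    l₁.direction = l₂.direction

end

noncomputable section

open Real Filter Topology

local notation "ℝ²" => EuclideanSpace ℝ (Fin 2)

/-- The point of the unit circle at angle `θ`. -/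
def circlePt (θ : ℝ) : ℝ² := !₂[cos θ, sin θ]

@[simp] lemma circlePt_zero_apply (θ : ℝ) : circlePt θ 0 = cos θ := rfl

@[simp] lemma circlePt_one_apply (θ : ℝ) : circlePt θ 1 = sin θ := rfl

/-- The component of `d` in the direction of angle `θ`. -/
def comp (θ : ℝ) (d : ℝ²) : ℝ := d 0 * cos θ + d 1 * sin θ

lemma comp_add_pi (θ : ℝ) (d : ℝ²) : comp (θ + π) d = -comp θ d := by
  simp [comp]; ring

lemma comp_add_pi_div_two (θ : ℝ) (d : ℝ²) :
    comp (θ + π / 2) d = -(d 0 * sin θ) + d 1 * cos θ := by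
  simp [comp, cos_add_pi_div_two, sin_add_pi_div_two]

lemma norm_sq_eq_comp (θ : ℝ) (d : ℝ²) :
    ‖d‖ ^ 2 = comp θ d ^ 2 + comp (θ + π / 2) d ^ 2 := by
  rw [comp_add_pi_div_two, EuclideanSpace.norm_sq_eq, comp]
  simp only [Fin.sum_univ_two, norm_eq_abs, sq_abs]
  linear_combination (-(d 0) ^ 2 - (d 1) ^ 2) * sin_sq_add_cos_sq θ

/-- `P` moved by `v`, in the orthonormal frame whose first vector has angle `θ`. -/
def framePt (P : ℝ²) (θ : ℝ) (v : ℝ × ℝ) : ℝ² :=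
  P + v.1 • circlePt θ + v.2 • circlePt (θ + π / 2)

lemma framePt_zero (P : ℝ²) (θ : ℝ) : framePt P θ 0 = P := by simp [framePt]

lemma continuous_framePt (P : ℝ²) (θ : ℝ) : Continuous (framePt P θ) := by
  unfold framePt; fun_prop

/-- The sign vectors of `v` and `w` with respect to the lines with normals in `N` agree and have
no zero entry. -/
def SameSide (N : Finset (ℝ × ℝ)) (v w : ℝ × ℝ) : Prop :=
  ∀ n ∈ N, 0 < (n.1 * v.1 + n.2 * v.2) * (n.1 * w.1 + n.2 * w.2)

lemma SameSide.symm {N : Finset (ℝ × ℝ)} {v w : ℝ × ℝ} (h : SameSide N v w) :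
    SameSide N w v := fun n hn => by
  have := h n hn
  rwa [mul_comm] at this

lemma SameSide.trans {N : Finset (ℝ × ℝ)} {u v w : ℝ × ℝ} (h : SameSide N u v)
    (h' : SameSide N v w) : SameSide N u w := fun n hn => by
  have h1 := h n hn
  have h2 := h' n hn
  rcases pos_and_pos_or_neg_and_neg_of_mul_pos h1 with ⟨a, b⟩ | ⟨a, b⟩
  · exact mul_pos a ((pos_iff_pos_of_mul_pos h2).1 b)
  · exact mul_pos_of_neg_of_neg a ((neg_iff_neg_of_mul_pos h2).1 b)

lemma SameSide.segment {N : Finset (ℝ × ℝ)} {u v w z : ℝ × ℝ} (hu : SameSide N u w)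
    (hv : SameSide N v w) (hz : z ∈ segment ℝ u v) : SameSide N z w := fun n hn => by
  obtain ⟨a, b, ha, hb, hab, rfl⟩ := hz
  have h1 := hu n hn
  have h2 := hv n hn
  simp only [Prod.fst_add, Prod.snd_add, Prod.smul_fst, Prod.smul_snd, smul_eq_mul]
  have : 0 < a * ((n.1 * u.1 + n.2 * u.2) * (n.1 * w.1 + n.2 * w.2)) +
      b * ((n.1 * v.1 + n.2 * v.2) * (n.1 * w.1 + n.2 * w.2)) := by
    rcases ha.eq_or_lt with rfl | ha
    · obtain rfl : b = 1 := by linarith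
      simpa using h2
    · have := mul_pos ha h1
      have := mul_nonneg hb h2.le
      linarith
  linarith

/-- Near `P` the coloring is off its boundary and described by `F` at all points
off the lines through `P` with normals in `N`. -/
structure IsLocalModel (B : Set ℝ²) (P : ℝ²) (θ : ℝ) (N : Finset (ℝ × ℝ))
    (F : ℝ × ℝ → Prop) : Prop where
  normal_ne : ∀ n ∈ N, n ≠ 0
  congr : ∀ v w, SameSide N v w → (F v ↔ F w)
  color : ∀ᶠ v in 𝓝 (0 : ℝ × ℝ), ∀ w, SameSide N v w →
    framePt P θ v ∉ frontier B ∧ (framePt P θ v ∈ B ↔ F w)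

lemma eventually_mem_iff_of_notMem_frontier {B : Set ℝ²} {x : ℝ²} (hx : x ∉ frontier B) :
    ∀ᶠ y in 𝓝 x, y ∉ frontier B ∧ (y ∈ B ↔ x ∈ B) := by
  have h1 : ∀ᶠ y in 𝓝 x, y ∉ frontier B := isClosed_frontier.isOpen_compl.mem_nhds hx
  rw [frontier_eq_inter_compl_interior] at hx
  simp only [Set.mem_inter_iff, Set.mem_compl_iff, not_and_or, not_not] at hx
  rcases hx with hx | hx
  · filter_upwards [h1, isOpen_interior.mem_nhds hx] with y h hy
    exact ⟨h, iff_of_true (interior_subset hy) (interior_subset hx)⟩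
  · filter_upwards [h1, isOpen_interior.mem_nhds hx] with y h hy
    exact ⟨h, iff_of_false (interior_subset hy) (interior_subset hx)⟩

lemma IsPreconnected.mem_of_disjoint_frontier {B C : Set ℝ²} (hC : IsPreconnected C)
    (hd : ∀ x ∈ C, x ∉ frontier B) {x y : ℝ²} (hx : x ∈ C) (hy : y ∈ C) (hxB : x ∈ B) :
    y ∈ B := by
  have hsub : C ⊆ interior B ∪ interior Bᶜ := fun z hz => by
    have := hd z hz
    rw [frontier_eq_inter_compl_interior] at this
    simpa only [Set.mem_inter_iff, Set.mem_compl_iff, not_and_or, not_not, Set.mem_union] using this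
  have hdis : Disjoint (interior B) (interior Bᶜ) :=
    disjoint_compl_right.mono interior_subset interior_subset
  have hxi : x ∈ interior B :=
    (hsub hx).resolve_right fun h => interior_subset h hxB
  exact interior_subset <| hC.subset_left_of_subset_union isOpen_interior isOpen_interior hdis
    hsub ⟨x, hx, hxi⟩ hy

lemma IsSeg.exists_normal {s : Set ℝ²} (hs : IsSeg s) (P : ℝ²) (θ : ℝ) :
    ∃ n : ℝ × ℝ, n ≠ 0 ∧ ∀ᶠ v in 𝓝 (0 : ℝ × ℝ),
      framePt P θ v ∈ s → n.1 * v.1 + n.2 * v.2 = 0 := by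
  obtain ⟨hcl, -, -, l, ⟨-, hl⟩, hsl⟩ := hs
  by_cases hP : P ∈ s
  · obtain ⟨w, hw, hspan⟩ := finrank_eq_one_iff'.1 hl
    refine ⟨(-comp (θ + π / 2) w, comp θ w), fun h => ?_, Eventually.of_forall fun v hv => ?_⟩
    · obtain ⟨h1, h2⟩ := Prod.mk.inj h
      have := norm_sq_eq_comp θ (w : ℝ²)
      rw [neg_eq_zero.1 h1, h2] at this
      apply hw
      simpa using this
    · have hdir := AffineSubspace.vsub_mem_direction (hsl hv) (hsl hP)
      obtain ⟨c, hc⟩ := hspan ⟨_, hdir⟩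
      have hc' : c • (w : ℝ²) = framePt P θ v - P := congrArg Subtype.val hc
      have h0 : c * (w : ℝ²) 0 = v.1 * cos θ - v.2 * sin θ := by
        have := congrArg (fun z : ℝ² => z 0) hc'
        simp [framePt, cos_add_pi_div_two] at this
        linarith
      have h1 : c * (w : ℝ²) 1 = v.1 * sin θ + v.2 * cos θ := by
        have := congrArg (fun z : ℝ² => z 1) hc'
        simp [framePt, sin_add_pi_div_two] at this
        linarith
      have e1 : v.1 = c * comp θ w := by
        unfold comp
        linear_combination -cos θ * h0 - sin θ * h1 - v.1 * sin_sq_add_cos_sq θ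
      have e2 : v.2 = c * comp (θ + π / 2) w := by
        rw [comp_add_pi_div_two]
        linear_combination sin θ * h0 - cos θ * h1 - v.2 * sin_sq_add_cos_sq θ
      dsimp only
      rw [e1, e2]
      ring
  · refine ⟨(1, 0), by simp, ?_⟩
    have h := (continuous_framePt P θ).tendsto 0
    rw [framePt_zero] at h
    filter_upwards [h (hcl.isOpen_compl.mem_nhds hP)] with v hv hv'
    exact absurd hv' hv

lemma IsPolygonal.exists_isLocalModel {B : Set ℝ²} {S : Set (Set ℝ²)} (h : IsPolygonal B S)
    (P : ℝ²) (θ : ℝ) : ∃ N F, IsLocalModel B P θ N F := by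
  classical
  have hfin := h.loc_finite _ (Metric.isBounded_ball (x := P) (r := 1))
  have hn : ∀ s : Set ℝ², ∃ n : ℝ × ℝ, s ∈ S → n ≠ 0 ∧ ∀ᶠ v in 𝓝 (0 : ℝ × ℝ),
      framePt P θ v ∈ s → n.1 * v.1 + n.2 * v.2 = 0 := fun s => by
    by_cases hs : s ∈ S
    · obtain ⟨n, hn⟩ := (h.seg s hs).exists_normal P θ
      exact ⟨n, fun _ => hn⟩
    · exact ⟨0, fun h => absurd h hs⟩
  choose n hn using hn
  have htend := (continuous_framePt P θ).tendsto 0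
  rw [framePt_zero] at htend
  have hev : ∀ᶠ v in 𝓝 (0 : ℝ × ℝ), framePt P θ v ∈ Metric.ball P 1 ∧
      ∀ s ∈ {s ∈ S | (s ∩ Metric.ball P 1).Nonempty},
        framePt P θ v ∈ s → (n s).1 * v.1 + (n s).2 * v.2 = 0 :=
    (htend.eventually_mem (Metric.ball_mem_nhds P one_pos)).and
      ((eventually_all_finite hfin).2 fun s hs => (hn s hs.1).2)
  obtain ⟨ρ, hρ, hball⟩ := Metric.eventually_nhds_iff_ball.1 hev
  set N := hfin.toFinset.image n with hN
  have hoff : ∀ v ∈ Metric.ball (0 : ℝ × ℝ) ρ, ∀ w, SameSide N v w →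
      framePt P θ v ∉ frontier B := fun v hv w hvw hfr => by
    rw [h.boundary] at hfr
    obtain ⟨s, hs, hvs⟩ := hfr
    have hmem : s ∈ {s ∈ S | (s ∩ Metric.ball P 1).Nonempty} := ⟨hs, _, hvs, (hball v hv).1⟩
    have h0 := (hball v hv).2 s hmem hvs
    have := hvw (n s) (Finset.mem_image_of_mem n (hfin.mem_toFinset.2 hmem))
    rw [h0, zero_mul] at this
    exact this.false
  refine ⟨N, fun w => ∃ v ∈ Metric.ball (0 : ℝ × ℝ) ρ, SameSide N v w ∧ framePt P θ v ∈ B,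
    ?_, ?_, ?_⟩
  · intro m hm
    obtain ⟨s, hs, rfl⟩ := Finset.mem_image.1 hm
    exact (hn s (hfin.mem_toFinset.1 hs).1).1
  · intro v w hvw
    exact ⟨fun ⟨u, hu, huv, huB⟩ => ⟨u, hu, huv.trans hvw, huB⟩,
      fun ⟨u, hu, huv, huB⟩ => ⟨u, hu, huv.trans hvw.symm, huB⟩⟩
  · filter_upwards [Metric.ball_mem_nhds (0 : ℝ × ℝ) hρ] with v hv w hvw
    refine ⟨hoff v hv w hvw, fun hB => ⟨v, hv, hvw, hB⟩, fun ⟨u, hu, huw, huB⟩ => ?_⟩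
    have hpre : IsPreconnected (framePt P θ '' segment ℝ u v) :=
      (convex_segment u v).isPreconnected.image _ (continuous_framePt P θ).continuousOn
    refine hpre.mem_of_disjoint_frontier ?_ (Set.mem_image_of_mem _ (left_mem_segment ℝ u v))
      (Set.mem_image_of_mem _ (right_mem_segment ℝ u v)) huB
    rintro _ ⟨z, hz, rfl⟩
    exact hoff z ((convex_ball 0 ρ).segment_subset hu hv hz) w (huw.segment hvw hz)

lemma eventually_pos_of_hasDerivAt {f : ℝ → ℝ} {k : ℝ} (hf : HasDerivAt f k 0) (hk : 0 < k)
    (h0 : f 0 = 0) : ∀ᶠ t in 𝓝[>] 0, 0 < f t := by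
  have := eventually_nhdsWithin_sign_eq_of_deriv_pos (by rwa [hf.deriv]) h0
  filter_upwards [nhdsWithin_le_nhds this, self_mem_nhdsWithin] with t ht ht0
  rw [sub_zero, sign_pos (Set.mem_Ioi.1 ht0)] at ht
  exact sign_eq_one_iff.1 ht

lemma hasDerivAt_sin_mul (s : ℝ) : HasDerivAt (fun t => sin (s * t)) s 0 := by
  simpa using ((hasDerivAt_id (0 : ℝ)).const_mul s).sin

lemma hasDerivAt_cos_mul (s : ℝ) : HasDerivAt (fun t => cos (s * t)) 0 0 := by
  simpa using ((hasDerivAt_id (0 : ℝ)).const_mul s).cos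

lemma eventually_cos_mul_lt_one {s : ℝ} (hs : s ≠ 0) : ∀ᶠ t in 𝓝[>] 0, cos (s * t) - 1 < 0 := by
  have hc : Tendsto (fun t : ℝ => s * t) (𝓝 0) (𝓝 0) := by
    have : Continuous fun t : ℝ => s * t := by fun_prop
    simpa using this.tendsto 0
  have hpi := two_pi_pos
  filter_upwards [nhdsWithin_le_nhds (hc.eventually (Ioo_mem_nhds (neg_lt_zero.2 hpi) hpi)),
    self_mem_nhdsWithin] with t ht ht0
  have hne : cos (s * t) ≠ 1 := fun h =>
    mul_ne_zero hs (Set.mem_Ioi.1 ht0).ne' ((cos_eq_one_iff_of_lt_of_lt ht.1 ht.2).1 h)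
  linarith [(cos_le_one (s * t)).lt_of_ne hne]

lemma add_circlePt_eq_framePt (X d : ℝ²) (θ t δ : ℝ) :
    X + t • d + circlePt (θ + δ) = framePt (X + circlePt θ) θ
      (t * comp θ d + (cos δ - 1), t * comp (θ + π / 2) d + sin δ) := by
  have h1 := sin_sq_add_cos_sq θ
  rw [comp_add_pi_div_two]
  ext i
  fin_cases i
  · simp [framePt, comp, cos_add]
    linear_combination -t * d 0 * h1
  · simp [framePt, comp, sin_add]
    linear_combination -t * d 1 * h1

lemma tendsto_frame_coord (θ s : ℝ) (d : ℝ²) :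
    Tendsto (fun t => (t * comp θ d + (cos (s * t) - 1), t * comp (θ + π / 2) d + sin (s * t)))
      (𝓝[>] 0) (𝓝 (0 : ℝ × ℝ)) := by
  have : Continuous fun t : ℝ =>
      (t * comp θ d + (cos (s * t) - 1), t * comp (θ + π / 2) d + sin (s * t)) := by fun_prop
  have h := this.tendsto 0
  simp only [zero_mul, mul_zero, cos_zero, sin_zero, sub_self, add_zero] at h
  exact h.mono_left nhdsWithin_le_nhds

section LocalModel

variable {B : Set ℝ²} {X : ℝ²} {θ : ℝ} {N : Finset (ℝ × ℝ)} {F : ℝ × ℝ → Prop}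

lemma IsLocalModel.eventually_color (hm : IsLocalModel B (X + circlePt θ) θ N F) (d : ℝ²)
    (s : ℝ) (w : ℝ × ℝ)
    (hw : ∀ᶠ t in 𝓝[>] 0, SameSide N
      (t * comp θ d + (cos (s * t) - 1), t * comp (θ + π / 2) d + sin (s * t)) w) :
    ∀ᶠ t in 𝓝[>] (0 : ℝ), X + t • d + circlePt (θ + s * t) ∉ frontier B ∧
      (X + t • d + circlePt (θ + s * t) ∈ B ↔ F w) := by
  filter_upwards [(tendsto_frame_coord θ s d).eventually hm.color, hw] with t ht hw
  rw [add_circlePt_eq_framePt]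
  exact ht w hw

lemma IsLocalModel.eventually_color_of_ne (hm : IsLocalModel B (X + circlePt θ) θ N F) (d : ℝ²)
    (s : ℝ) (hs : ∀ n ∈ N, n.1 * comp θ d + n.2 * (comp (θ + π / 2) d + s) ≠ 0) :
    ∀ᶠ t in 𝓝[>] (0 : ℝ), X + t • d + circlePt (θ + s * t) ∉ frontier B ∧
      (X + t • d + circlePt (θ + s * t) ∈ B ↔ F (comp θ d, comp (θ + π / 2) d + s)) := by
  refine hm.eventually_color d s _ ((eventually_all_finset N).2 fun n hn => ?_)
  set K := n.1 * comp θ d + n.2 * (comp (θ + π / 2) d + s) with hK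
  refine eventually_pos_of_hasDerivAt (k := K * K) ?_ (mul_self_pos.2 (hs n hn)) (by simp)
  have h1 : HasDerivAt (fun t : ℝ => t * comp θ d + (cos (s * t) - 1)) (1 * comp θ d + 0) 0 :=
    ((hasDerivAt_id (0 : ℝ)).mul_const _).add ((hasDerivAt_cos_mul s).sub_const 1)
  have h2 : HasDerivAt (fun t : ℝ => t * comp (θ + π / 2) d + sin (s * t))
      (1 * comp (θ + π / 2) d + s) 0 :=
    ((hasDerivAt_id (0 : ℝ)).mul_const _).add (hasDerivAt_sin_mul s)
  have h3 := ((h1.const_mul n.1).add (h2.const_mul n.2)).mul_const K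
  rwa [one_mul, one_mul, add_zero, ← hK] at h3

/-- All directions `(a, b)` with `a < 0` of slope at least `M` in absolute value lie in one of two
fixed sectors. -/
def IsSteep (N : Finset (ℝ × ℝ)) (M : ℝ) : Prop :=
  ∀ a b : ℝ, a < 0 → (M * -a ≤ b → SameSide N (a, b) (-1, M)) ∧
    (b ≤ M * a → SameSide N (a, b) (-1, -M))

lemma IsLocalModel.exists_isSteep {P : ℝ²} (hm : IsLocalModel B P θ N F) : ∃ M, IsSteep N M := by
  have h : ∀ᶠ M in atTop, ∀ n ∈ N, |n.1| < M * |n.2| ∨ n.2 = 0 := by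
    refine (eventually_all_finset N).2 fun n _ => ?_
    by_cases h0 : n.2 = 0
    · exact Eventually.of_forall fun _ => Or.inr h0
    · filter_upwards [eventually_gt_atTop (|n.1| / |n.2|)] with M hM
      exact Or.inl ((div_lt_iff₀ (abs_pos.2 h0)).1 hM)
  obtain ⟨M, hM⟩ := h.exists
  refine ⟨M, fun a b ha => ⟨fun hb n hn => ?_, fun hb n hn => ?_⟩⟩
  all_goals
    dsimp only
    rcases hM n hn with h | h
    · obtain ⟨h1, h2⟩ := abs_lt.1 h
      rcases lt_trichotomy n.2 0 with hq | hq | hq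
      · rw [abs_of_neg hq] at h1 h2
        first
        | exact mul_pos_of_neg_of_neg (by nlinarith) (by linarith)
        | exact mul_pos (by nlinarith) (by linarith)
      · simp [hq] at h
        linarith [abs_nonneg n.1]
      · rw [abs_of_pos hq] at h1 h2
        first
        | exact mul_pos (by nlinarith) (by linarith)
        | exact mul_pos_of_neg_of_neg (by nlinarith) (by linarith)
    · have hp : n.1 ≠ 0 := fun hp => hm.normal_ne n hn (Prod.ext hp h)
      rw [h]
      have := mul_pos (mul_self_pos.2 hp) (neg_pos.2 ha)
      linarith

lemma IsLocalModel.eventually_color_steep (hm : IsLocalModel B (X + circlePt θ) θ N F) {M : ℝ}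
    (hM : IsSteep N M) {d : ℝ²} (hd : comp θ d = 0) {s : ℝ} (hs : s ≠ 0)
    (hk : 0 < comp (θ + π / 2) d + s) :
    ∀ᶠ t in 𝓝[>] (0 : ℝ), X + t • d + circlePt (θ + s * t) ∉ frontier B ∧
      (X + t • d + circlePt (θ + s * t) ∈ B ↔ F (-1, M)) := by
  refine hm.eventually_color d s _ ?_
  have h1 : HasDerivAt (fun t : ℝ => t * comp (θ + π / 2) d + sin (s * t) -
      M * (1 - cos (s * t))) (1 * comp (θ + π / 2) d + s - M * (0 - 0)) 0 :=
    (((hasDerivAt_id (0 : ℝ)).mul_const _).add (hasDerivAt_sin_mul s)).sub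
      (((hasDerivAt_const (0 : ℝ) (1 : ℝ)).sub (hasDerivAt_cos_mul s)).const_mul M)
  filter_upwards [eventually_pos_of_hasDerivAt h1 (by linarith) (by simp),
    eventually_cos_mul_lt_one hs] with t ht hc
  exact (hM _ _ (by rw [hd]; linarith)).1 (by rw [hd]; linarith)

lemma IsLocalModel.eventually_color_steep_neg (hm : IsLocalModel B (X + circlePt θ) θ N F)
    {M : ℝ} (hM : IsSteep N M) {d : ℝ²} (hd : comp θ d = 0) {s : ℝ} (hs : s ≠ 0)
    (hk : comp (θ + π / 2) d + s < 0) :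
    ∀ᶠ t in 𝓝[>] (0 : ℝ), X + t • d + circlePt (θ + s * t) ∉ frontier B ∧
      (X + t • d + circlePt (θ + s * t) ∈ B ↔ F (-1, -M)) := by
  refine hm.eventually_color d s _ ?_
  have h1 : HasDerivAt (fun t : ℝ => -(M * (1 - cos (s * t))) -
      (t * comp (θ + π / 2) d + sin (s * t))) (-(M * (0 - 0)) - (1 * comp (θ + π / 2) d + s)) 0 :=
    (((hasDerivAt_const (0 : ℝ) (1 : ℝ)).sub (hasDerivAt_cos_mul s)).const_mul M).neg.sub
      (((hasDerivAt_id (0 : ℝ)).mul_const _).add (hasDerivAt_sin_mul s))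
  filter_upwards [eventually_pos_of_hasDerivAt h1 (by linarith) (by simp),
    eventually_cos_mul_lt_one hs] with t ht hc
  exact (hM _ _ (by rw [hd]; linarith)).2 (by rw [hd]; linarith)

lemma eventually_nhdsNE_of_pos_neg {p : ℝ → Prop} {θ : ℝ} (h1 : ∀ᶠ t in 𝓝[>] 0, p (θ + 1 * t))
    (h2 : ∀ᶠ t in 𝓝[>] 0, p (θ + -1 * t)) : ∀ᶠ x in 𝓝[≠] θ, p x := by
  rw [← nhdsLT_sup_nhdsGT, eventually_sup]
  constructor
  · have ht : Tendsto (fun x : ℝ => θ - x) (𝓝[<] θ) (𝓝[>] 0) := by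
      refine tendsto_nhdsWithin_iff.2 ⟨?_, ?_⟩
      · have : Continuous fun x : ℝ => θ - x := by fun_prop
        simpa using (this.tendsto θ).mono_left nhdsWithin_le_nhds
      · filter_upwards [self_mem_nhdsWithin] with x hx
        exact Set.mem_Ioi.2 (sub_pos.2 (Set.mem_Iio.1 hx))
    filter_upwards [ht.eventually h2] with x hx
    simpa using hx
  · have ht : Tendsto (fun x : ℝ => x - θ) (𝓝[>] θ) (𝓝[>] 0) := by
      refine tendsto_nhdsWithin_iff.2 ⟨?_, ?_⟩
      · have : Continuous fun x : ℝ => x - θ := by fun_prop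
        simpa using (this.tendsto θ).mono_left nhdsWithin_le_nhds
      · filter_upwards [self_mem_nhdsWithin] with x hx
        exact Set.mem_Ioi.2 (sub_pos.2 (Set.mem_Ioi.1 hx))
    filter_upwards [ht.eventually h1] with x hx
    simpa using hx

lemma comp_zero (θ : ℝ) : comp θ 0 = 0 := by simp [comp]

lemma IsLocalModel.eventually_circle (hm : IsLocalModel B (X + circlePt θ) θ N F)
    {M : ℝ} (hM : IsSteep N M) :
    (∀ᶠ t in 𝓝[>] (0 : ℝ), X + circlePt (θ + 1 * t) ∉ frontier B ∧
      (X + circlePt (θ + 1 * t) ∈ B ↔ F (-1, M))) ∧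
    (∀ᶠ t in 𝓝[>] (0 : ℝ), X + circlePt (θ + -1 * t) ∉ frontier B ∧
      (X + circlePt (θ + -1 * t) ∈ B ↔ F (-1, -M))) := by
  have h1 := hm.eventually_color_steep hM (comp_zero θ) one_ne_zero (by simp [comp_zero])
  have h2 := hm.eventually_color_steep_neg hM (comp_zero θ) (neg_ne_zero.2 one_ne_zero)
    (by simp [comp_zero])
  simp only [smul_zero, add_zero] at h1 h2
  exact ⟨h1, h2⟩

end LocalModel

/-- The color of the unit circle around `X` is not constant near the angle `θ`. -/
def IsColorChange (B : Set ℝ²) (X : ℝ²) (θ : ℝ) : Prop :=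
  ∀ b : Prop, ¬∀ᶠ x in 𝓝[≠] θ, (X + circlePt x ∈ B ↔ b)

lemma IsLocalModel.iff_not_of_isColorChange {B : Set ℝ²} {X : ℝ²} {θ : ℝ} {N : Finset (ℝ × ℝ)}
    {F : ℝ × ℝ → Prop} (hm : IsLocalModel B (X + circlePt θ) θ N F) {M : ℝ} (hM : IsSteep N M)
    (hc : IsColorChange B X θ) : F (-1, M) ↔ ¬F (-1, -M) := by
  by_contra hne
  have heq : F (-1, -M) ↔ F (-1, M) := by tauto
  obtain ⟨h1, h2⟩ := hm.eventually_circle hM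
  refine hc (F (-1, M)) (eventually_nhdsNE_of_pos_neg (h1.mono fun t ht => ht.2)
    (h2.mono fun t ht => ht.2.trans heq))

lemma norm_circlePt (θ : ℝ) : ‖circlePt θ‖ = 1 := by
  simp [EuclideanSpace.norm_eq]

lemma norm_circlePt_sub (θ : ℝ) : ‖circlePt θ - circlePt (θ + π / 3)‖ = 1 := by
  have h3 : √3 ^ 2 = 3 := sq_sqrt (by norm_num)
  rw [EuclideanSpace.norm_eq, sqrt_eq_one]
  simp only [PiLp.sub_apply, circlePt_zero_apply, circlePt_one_apply, norm_eq_abs, sq_abs,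
    Fin.sum_univ_two, cos_add, sin_add, cos_pi_div_three, sin_pi_div_three]
  linear_combination sin_sq_add_cos_sq θ + (sin θ ^ 2 + cos θ ^ 2) / 4 * h3

section Coloring

variable {B : Set ℝ²} {S : Set (Set ℝ²)}

lemma circlePt_mem_iff_notMem (h : IsPolygonal B S) (hC3 : C3 B) {A : ℝ²}
    (hA : A ∈ frontier B) {θ : ℝ} (h1 : A + circlePt θ ∉ frontier B)
    (h2 : A + circlePt (θ + π / 3) ∉ frontier B) :
    A + circlePt θ ∈ B ↔ A + circlePt (θ + π / 3) ∉ B := by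
  have hev : ∀ φ, A + circlePt φ ∉ frontier B → ∀ᶠ Q in 𝓝 A,
      Q + circlePt φ ∉ frontier B ∧ (Q + circlePt φ ∈ B ↔ A + circlePt φ ∈ B) := fun φ hφ =>
    ((continuous_id.add continuous_const).tendsto A).eventually
      (eventually_mem_iff_of_notMem_frontier hφ)
  have htri : ∀ Q : ℝ², dist Q (Q + circlePt θ) = 1 ∧
      dist (Q + circlePt θ) (Q + circlePt (θ + π / 3)) = 1 ∧
      dist (Q + circlePt (θ + π / 3)) Q = 1 := fun Q => by
    refine ⟨by simp [norm_circlePt], ?_, by simp [dist_eq_norm, norm_circlePt]⟩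
    rw [dist_add_left, dist_eq_norm, norm_circlePt_sub]
  have hcl := frontier_eq_closure_inter_closure (s := B) ▸ hA
  have hb : A ∈ closure (interior B) := closure_minimal h.black_sub isClosed_closure hcl.1
  have hw : A ∈ closure (interior Bᶜ) := closure_minimal h.white_sub isClosed_closure hcl.2
  by_contra hne
  have heq : A + circlePt (θ + π / 3) ∈ B ↔ A + circlePt θ ∈ B := by tauto
  have hboth := (hev _ h1).and (hev _ h2)
  by_cases hB : A + circlePt θ ∈ B
  · obtain ⟨Q, hQ, ⟨f1, m1⟩, f2, m2⟩ :=
      ((mem_closure_iff_frequently.1 hb).and_eventually hboth).exists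
    rcases hC3 Q _ _ (htri Q).1 (htri Q).2.1 (htri Q).2.2
      (Or.inl ⟨interior_subset hQ, m1.2 hB, m2.2 (heq.2 hB)⟩) with hf | hf | hf
    exacts [disjoint_interior_frontier.le_bot ⟨hQ, hf⟩, f1 hf, f2 hf]
  · obtain ⟨Q, hQ, ⟨f1, m1⟩, f2, m2⟩ :=
      ((mem_closure_iff_frequently.1 hw).and_eventually hboth).exists
    rcases hC3 Q _ _ (htri Q).1 (htri Q).2.1 (htri Q).2.2
      (Or.inr ⟨interior_subset hQ, fun hh => hB (m1.1 hh), fun hh => hB (heq.1 (m2.1 hh))⟩)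
      with hf | hf | hf
    exacts [disjoint_interior_frontier.le_bot ⟨hQ, frontier_compl B ▸ hf⟩, f1 hf, f2 hf]

lemma eventually_circlePt_notMem_frontier (h : IsPolygonal B S) (A : ℝ²) (θ : ℝ) :
    ∀ᶠ x in 𝓝[≠] θ, A + circlePt x ∉ frontier B := by
  obtain ⟨N, F, hm⟩ := h.exists_isLocalModel (A + circlePt θ) θ
  obtain ⟨M, hM⟩ := hm.exists_isSteep
  obtain ⟨h1, h2⟩ := hm.eventually_circle hM
  exact eventually_nhdsNE_of_pos_neg (h1.mono fun t ht => ht.1) (h2.mono fun t ht => ht.1)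

lemma tendsto_add_const_nhdsNE (θ c : ℝ) : Tendsto (· + c) (𝓝[≠] θ) (𝓝[≠] (θ + c)) := by
  refine tendsto_nhdsWithin_iff.2 ⟨?_, ?_⟩
  · exact ((continuous_id.add continuous_const).tendsto θ).mono_left nhdsWithin_le_nhds
  · filter_upwards [self_mem_nhdsWithin] with x hx
    simpa using hx

lemma eventually_circlePt_mem_iff_notMem (h : IsPolygonal B S) (hC3 : C3 B) {A : ℝ²}
    (hA : A ∈ frontier B) (θ : ℝ) :
    ∀ᶠ x in 𝓝[≠] θ, (A + circlePt x ∈ B ↔ A + circlePt (x + π / 3) ∉ B) := by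
  filter_upwards [eventually_circlePt_notMem_frontier h A θ,
    (tendsto_add_const_nhdsNE θ (π / 3)).eventually
      (eventually_circlePt_notMem_frontier h A (θ + π / 3))] with x h1 h2
  exact circlePt_mem_iff_notMem h hC3 hA h1 h2

lemma continuous_circlePt : Continuous circlePt := by
  unfold circlePt; fun_prop

lemma circlePt_mem_iff_notMem_pi (h : IsPolygonal B S) (hC3 : C3 B) {A : ℝ²}
    (hA : A ∈ frontier B) {θ : ℝ} (h1 : A + circlePt θ ∉ frontier B)
    (h2 : A + circlePt (θ + π) ∉ frontier B) :
    A + circlePt θ ∈ B ↔ A + circlePt (θ + π) ∉ B := by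
  have hstep := eventually_circlePt_mem_iff_notMem h hC3 hA
  have hcont : Continuous fun x => A + circlePt x := continuous_const.add continuous_circlePt
  have e1 := Filter.Eventually.filter_mono (nhdsWithin_le_nhds (s := {θ}ᶜ))
    ((hcont.tendsto θ).eventually (eventually_mem_iff_of_notMem_frontier h1))
  have e2 := Filter.Eventually.filter_mono (nhdsWithin_le_nhds (s := {θ + π}ᶜ))
    ((hcont.tendsto (θ + π)).eventually (eventually_mem_iff_of_notMem_frontier h2))
  have t1 := tendsto_add_const_nhdsNE θ (π / 3)
  have t2 := tendsto_add_const_nhdsNE (θ + π / 3) (π / 3)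
  obtain ⟨x, ⟨-, x1⟩, x2, x3, x4, x5⟩ := (e1.and (((tendsto_add_const_nhdsNE θ π).eventually
    e2).and ((hstep θ).and ((t1.eventually (hstep _)).and
      ((t2.comp t1).eventually (hstep _)))))).exists
  have hx : x + π / 3 + π / 3 + π / 3 = x + π := by ring
  simp only [Function.comp_apply, hx] at x5
  have := x2.2
  tauto

lemma IsColorChange.add_pi_div_three (h : IsPolygonal B S) (hC3 : C3 B) {A : ℝ²}
    (hA : A ∈ frontier B) {θ : ℝ} (hc : IsColorChange B A θ) :
    IsColorChange B A (θ + π / 3) := fun b hb => by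
  refine hc (¬b) ?_
  filter_upwards [(tendsto_add_const_nhdsNE θ (π / 3)).eventually hb,
    eventually_circlePt_mem_iff_notMem h hC3 hA θ] with x h1 h2
  exact h2.trans (not_congr h1)

lemma exists_isColorChange (h : IsPolygonal B S) (hC3 : C3 B) {A : ℝ²}
    (hA : A ∈ frontier B) : ∃ θ, IsColorChange B A θ := by
  by_contra hno
  have hno' : ∀ θ, (∀ᶠ x in 𝓝[≠] θ, A + circlePt x ∈ B) ∨
      ∀ᶠ x in 𝓝[≠] θ, A + circlePt x ∉ B := fun θ => by
    have : ¬IsColorChange B A θ := fun h => hno ⟨θ, h⟩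
    simp only [IsColorChange, not_forall, not_not] at this
    obtain ⟨b, hb⟩ := this
    by_cases hbt : b
    · exact Or.inl (hb.mono fun x hx => hx.2 hbt)
    · exact Or.inr (hb.mono fun x hx hx' => hbt (hx.1 hx'))
  have hopen : ∀ p : ℝ → Prop, IsOpen {θ | ∀ᶠ x in 𝓝[≠] θ, p x} := fun p => by
    refine isOpen_iff_mem_nhds.2 fun θ hθ => ?_
    have h1 : ∀ᶠ y in 𝓝[≠] θ, ∀ᶠ x in 𝓝[≠] y, p x := by
      filter_upwards [eventually_eventually_nhdsWithin.2 hθ, self_mem_nhdsWithin] with y hy hyθ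
      rw [isOpen_compl_singleton.nhdsWithin_eq hyθ] at hy
      exact nhdsWithin_le_nhds hy
    rw [← nhdsNE_sup_pure θ]
    exact eventually_sup.2 ⟨h1, hθ⟩
  have hdisj : ∀ θ, (∀ᶠ x in 𝓝[≠] θ, A + circlePt x ∈ B) →
      ¬∀ᶠ x in 𝓝[≠] θ, A + circlePt x ∉ B := fun θ h1 h2 => by
    obtain ⟨x, hx, hx'⟩ := (h1.and h2).exists
    exact hx' hx
  have hclopen : IsClopen {θ | ∀ᶠ x in 𝓝[≠] θ, A + circlePt x ∈ B} := by
    refine ⟨⟨?_⟩, hopen _⟩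
    convert hopen fun x => A + circlePt x ∉ B using 1
    ext θ
    exact ⟨fun hθ => (hno' θ).resolve_left hθ, fun h2 h1 => hdisj θ h1 h2⟩
  have hflip := eventually_circlePt_mem_iff_notMem h hC3 hA 0
  have htr := tendsto_add_const_nhdsNE 0 (π / 3)
  rcases isClopen_iff.1 hclopen with he | he
  · have hall : ∀ θ, ∀ᶠ x in 𝓝[≠] θ, A + circlePt x ∉ B := fun θ =>
      (hno' θ).resolve_left fun hθ => (he ▸ hθ : θ ∈ (∅ : Set ℝ))
    obtain ⟨x, h1, h2, h3⟩ := ((hall 0).and ((htr.eventually (hall _)).and hflip)).exists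
    exact h1 (h3.2 h2)
  · have hall : ∀ θ, ∀ᶠ x in 𝓝[≠] θ, A + circlePt x ∈ B := fun θ =>
      (he ▸ Set.mem_univ θ : θ ∈ {θ | ∀ᶠ x in 𝓝[≠] θ, A + circlePt x ∈ B})
    obtain ⟨x, h1, h2, h3⟩ := ((hall 0).and ((htr.eventually (hall _)).and hflip)).exists
    exact h3.1 h1 h2

lemma opposite_of_eventually (h : IsPolygonal B S) (hC3 : C3 B) {X e : ℝ²} {θ s : ℝ}
    {p q : Prop} (he : ∀ᶠ t in 𝓝[>] (0 : ℝ), X + t • e ∈ frontier B)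
    (hp : ∀ᶠ t in 𝓝[>] (0 : ℝ), X + t • e + circlePt (θ + s * t) ∉ frontier B ∧
      (X + t • e + circlePt (θ + s * t) ∈ B ↔ p))
    (hq : ∀ᶠ t in 𝓝[>] (0 : ℝ), X + t • e + circlePt (θ + π + s * t) ∉ frontier B ∧
      (X + t • e + circlePt (θ + π + s * t) ∈ B ↔ q)) : p ↔ ¬q := by
  obtain ⟨t, a, b, c⟩ := (he.and (hp.and hq)).exists
  rw [add_right_comm θ] at c
  have := circlePt_mem_iff_notMem_pi h hC3 a b.1 c.1
  rwa [b.2, c.2] at this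

/-- Color changes on the circle around `X` do not occur perpendicularly to boundary directions. -/
lemma comp_ne_zero_of_isColorChange (h : IsPolygonal B S) (hC3 : C3 B) {X : ℝ²}
    (hX : X ∈ frontier B) {θ : ℝ} (hc : IsColorChange B X θ) (hc' : IsColorChange B X (θ + π))
    {d : ℝ²} (hd : ‖d‖ = 1) (hdir : ∀ᶠ t in 𝓝[>] (0 : ℝ), X + t • d ∈ frontier B) :
    comp θ d ≠ 0 := fun h0 => by
  obtain ⟨N, F, hm⟩ := h.exists_isLocalModel (X + circlePt θ) θ
  obtain ⟨M, hM⟩ := hm.exists_isSteep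
  obtain ⟨N', F', hm'⟩ := h.exists_isLocalModel (X + circlePt (θ + π)) (θ + π)
  obtain ⟨M', hM'⟩ := hm'.exists_isSteep
  have i1 := hm.iff_not_of_isColorChange hM hc
  have i2 := hm'.iff_not_of_isColorChange hM' hc'
  have h0' : comp (θ + π) d = 0 := by rw [comp_add_pi, h0, neg_zero]
  have hcomp : comp (θ + π + π / 2) d = -comp (θ + π / 2) d := by
    rw [add_right_comm, comp_add_pi]
  have j1 := opposite_of_eventually h hC3 (e := 0) (Eventually.of_forall fun t => by simpa using hX)
    (hm.eventually_color_steep hM (comp_zero θ) one_ne_zero (by simp [comp_zero]))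
    (hm'.eventually_color_steep hM' (comp_zero _) one_ne_zero (by simp [comp_zero]))
  have hsq : comp (θ + π / 2) d = 1 ∨ comp (θ + π / 2) d = -1 := by
    have := norm_sq_eq_comp θ d
    rw [hd, h0] at this
    exact eq_or_eq_neg_of_sq_eq_sq _ _ (by linarith)
  have hhalf : (1 / 2 : ℝ) ≠ 0 := by norm_num
  rcases hsq with h1 | h1
  · have := opposite_of_eventually h hC3 hdir (hm.eventually_color_steep hM h0 hhalf (by rw [h1]; norm_num))
      (hm'.eventually_color_steep_neg hM' h0' hhalf (by rw [hcomp, h1]; norm_num))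
    tauto
  · have := opposite_of_eventually h hC3 hdir (hm.eventually_color_steep_neg hM h0 hhalf (by rw [h1]; norm_num))
      (hm'.eventually_color_steep hM' h0' hhalf (by rw [hcomp, h1]; norm_num))
    tauto

lemma iff_of_countable_periodic {H : ℝ → Prop} {M T : ℝ} (hpos : ∀ p, M ≤ p → (H p ↔ H M))
    (hneg : ∀ p, p ≤ -M → (H p ↔ H (-M))) (hT : T ≠ 0) {E : Set ℝ} (hE : E.Countable)
    (hper : ∀ p, p ∉ E → (H p ↔ H (p + T))) : H M ↔ H (-M) := by
  have hE' : (⋃ j : ℤ, (fun p : ℝ => p + j * T) ⁻¹' E).Countable :=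
    Set.countable_iUnion fun j => hE.preimage (add_left_injective _)
  obtain ⟨p, hp⟩ := (hE'.dense_compl ℝ).nonempty
  simp only [Set.mem_compl_iff, Set.mem_iUnion, Set.mem_preimage, not_exists] at hp
  have hall : ∀ j : ℤ, H (p + j * T) ↔ H p := fun j => by
    induction j with
    | zero => simp
    | succ i ih =>
      rw [← ih, hper _ (hp i)]
      push_cast
      ring_nf
    | pred i ih =>
      rw [← ih, hper _ (hp _)]
      push_cast
      ring_nf
  have hlarge : ∀ L : ℝ, ∃ j : ℤ, L ≤ j * T := fun L => by
    rcases hT.lt_or_gt with h | h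
    · obtain ⟨j, hj⟩ := exists_int_lt (L / T)
      exact ⟨j, ((lt_div_iff_of_neg h).1 hj).le⟩
    · obtain ⟨j, hj⟩ := exists_int_gt (L / T)
      exact ⟨j, ((div_lt_iff₀ h).1 hj).le⟩
  obtain ⟨j, hj⟩ := hlarge (M - p)
  obtain ⟨k, hk⟩ := hlarge (M + p)
  have e1 := hpos (p + j * T) (by linarith)
  have e2 := hneg (p + (-k : ℤ) * T) (by push_cast; linarith)
  rw [hall] at e1 e2
  exact e1.symm.trans e2

lemma IsLocalModel.smul_iff {P : ℝ²} {θ : ℝ} {N : Finset (ℝ × ℝ)} {F : ℝ × ℝ → Prop}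
    (hm : IsLocalModel B P θ N F) {r : ℝ} (hr : 0 < r) {v w : ℝ × ℝ} (hv : v = r • w)
    (hw : ∀ n ∈ N, n.1 * w.1 + n.2 * w.2 ≠ 0) : F v ↔ F w := by
  refine hm.congr _ _ fun n hn => ?_
  have := mul_pos hr (mul_self_pos.2 (hw n hn))
  rw [hv, Prod.smul_fst, Prod.smul_snd, smul_eq_mul, smul_eq_mul]
  linarith

lemma IsLocalModel.finite_setOf_eq_zero {P : ℝ²} {θ : ℝ} {N : Finset (ℝ × ℝ)}
    {F : ℝ × ℝ → Prop} (hm : IsLocalModel B P θ N F) {a : ℝ} (ha : a ≠ 0) :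
    {p : ℝ | ∃ n ∈ N, n.1 * a + n.2 * p = 0}.Finite := by
  refine (N.finite_toSet.image fun n => -(n.1 * a) / n.2).subset ?_
  rintro p ⟨n, hn, hp⟩
  refine ⟨n, hn, ?_⟩
  have h2 : n.2 ≠ 0 := fun h2 => by
    rw [h2, zero_mul, add_zero] at hp
    exact hm.normal_ne n hn (Prod.ext ((mul_eq_zero.1 hp).resolve_right ha) h2)
  dsimp only
  rw [div_eq_iff h2]
  linarith

/-- At a boundary direction `d` pointing to the side of `circlePt θ`, the local colorings at
`X + circlePt θ` and `X - circlePt θ` are related by a reflection of slopes. -/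
lemma local_colors_opposite (h : IsPolygonal B S) (hC3 : C3 B) {X d : ℝ²} {θ : ℝ}
    (hdir : ∀ᶠ t in 𝓝[>] (0 : ℝ), X + t • d ∈ frontier B) (hpos : 0 < comp θ d)
    {N N' : Finset (ℝ × ℝ)} {F F' : ℝ × ℝ → Prop}
    (hm : IsLocalModel B (X + circlePt θ) θ N F)
    (hm' : IsLocalModel B (X + circlePt (θ + π)) (θ + π) N' F') {p : ℝ}
    (hp : ∀ n ∈ N', n.1 * (-1) + n.2 * p ≠ 0)
    (hp' : ∀ n ∈ N, n.1 * 1 + n.2 * (p + 2 * (comp (θ + π / 2) d / comp θ d)) ≠ 0) :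
    F (1, p + 2 * (comp (θ + π / 2) d / comp θ d)) ↔ ¬F' (-1, p) := by
  set r := comp θ d with hr
  set c := comp (θ + π / 2) d with hc
  have hr' : comp (θ + π) d = -r := comp_add_pi θ d
  have hc' : comp (θ + π + π / 2) d = -c := by rw [add_right_comm, comp_add_pi]
  have hv : (r, c + (c + r * p)) = r • ((1, p + 2 * (c / r)) : ℝ × ℝ) := by
    ext
    · simp
    · simp only [Prod.smul_mk, smul_eq_mul]
      field_simp
      ring
  have hv' : (-r, -c + (c + r * p)) = r • ((-1, p) : ℝ × ℝ) := by
    ext <;> simp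
  have e1 := hm.smul_iff hpos hv hp'
  have e2 := hm'.smul_iff hpos hv' hp
  rw [← e1, ← e2]
  have g1 : ∀ n ∈ N, n.1 * r + n.2 * (c + (c + r * p)) ≠ 0 := fun n hn h0 => by
    have := congrArg Prod.snd hv
    simp only [Prod.smul_mk, smul_eq_mul] at this
    rw [this] at h0
    exact mul_ne_zero hpos.ne' (hp' n hn) (by linarith)
  have g2 : ∀ n ∈ N', n.1 * comp (θ + π) d + n.2 * (comp (θ + π + π / 2) d + (c + r * p)) ≠ 0 :=
    fun n hn h0 => by
      rw [hr', hc'] at h0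
      exact mul_ne_zero hpos.ne' (hp n hn) (by linarith)
  have := opposite_of_eventually h hC3 hdir (hm.eventually_color_of_ne d (c + r * p) g1)
    (hm'.eventually_color_of_ne d (c + r * p) g2)
  rwa [hr', hc'] at this

lemma eq_of_comp_pos_of_comp_pos (h : IsPolygonal B S) (hC3 : C3 B) {X : ℝ²} {θ : ℝ}
    (hc' : IsColorChange B X (θ + π)) {d₁ d₂ : ℝ²} (hd₁ : ‖d₁‖ = 1) (hd₂ : ‖d₂‖ = 1)
    (hdir₁ : ∀ᶠ t in 𝓝[>] (0 : ℝ), X + t • d₁ ∈ frontier B)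
    (hdir₂ : ∀ᶠ t in 𝓝[>] (0 : ℝ), X + t • d₂ ∈ frontier B)
    (h₁ : 0 < comp θ d₁) (h₂ : 0 < comp θ d₂) : d₁ = d₂ := by
  obtain ⟨N, F, hm⟩ := h.exists_isLocalModel (X + circlePt θ) θ
  obtain ⟨N', F', hm'⟩ := h.exists_isLocalModel (X + circlePt (θ + π)) (θ + π)
  obtain ⟨M, hM⟩ := hm'.exists_isSteep
  have hne := hm'.iff_not_of_isColorChange hM hc'
  set a₁ := comp (θ + π / 2) d₁ / comp θ d₁ with ha₁
  set a₂ := comp (θ + π / 2) d₂ / comp θ d₂ with ha₂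
  have ha : a₁ = a₂ := by
    by_contra hane
    have hE := (hm.finite_setOf_eq_zero one_ne_zero).countable
    have hE' := (hm'.finite_setOf_eq_zero (neg_ne_zero.2 one_ne_zero)).countable
    have hinj : ∀ b : ℝ, Function.Injective fun p : ℝ => p + b := fun b => add_left_injective b
    have := iff_of_countable_periodic (H := fun p => F' (-1, p)) (M := M) (T := 2 * (a₁ - a₂))
      (fun p hp => hm'.congr _ _ ((hM (-1) p (by norm_num)).1 (by linarith)))
      (fun p hp => hm'.congr _ _ ((hM (-1) p (by norm_num)).2 (by linarith)))
      (mul_ne_zero two_ne_zero (sub_ne_zero.2 hane))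
      ((hE'.union (hE'.preimage (hinj (2 * (a₁ - a₂))))).union (hE.preimage (hinj (2 * a₁))))
      (fun p hp => by
        simp only [Set.mem_union, not_or, Set.mem_preimage, Set.mem_ofPred_eq, not_exists,
          not_and] at hp
        obtain ⟨⟨p1, p2⟩, p3⟩ := hp
        have hq : p + 2 * (a₁ - a₂) + 2 * a₂ = p + 2 * a₁ := by ring
        have r1 := local_colors_opposite h hC3 hdir₁ h₁ hm hm' p1 p3
        have r2 := local_colors_opposite h hC3 hdir₂ h₂ hm hm' p2 (by rw [← ha₂, hq]; exact p3)
        rw [← ha₂, hq] at r2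
        exact not_iff_not.1 (r1.symm.trans r2))
    tauto
  have e1 : comp (θ + π / 2) d₁ = a₁ * comp θ d₁ := (div_mul_cancel₀ _ h₁.ne').symm
  have e2 : comp (θ + π / 2) d₂ = a₁ * comp θ d₂ := ha ▸ (div_mul_cancel₀ _ h₂.ne').symm
  have n1 := norm_sq_eq_comp θ d₁
  have n2 := norm_sq_eq_comp θ d₂
  rw [hd₁, e1] at n1
  rw [hd₂, e2] at n2
  have hcomp : comp θ d₁ = comp θ d₂ := by
    refine (sq_eq_sq₀ h₁.le h₂.le).1 ?_
    have : (1 + a₁ ^ 2) * (comp θ d₁ ^ 2 - comp θ d₂ ^ 2) = 0 := by linarith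
    rcases mul_eq_zero.1 this with h0 | h0
    · nlinarith
    · linarith
  have hcomp' : comp (θ + π / 2) d₁ = comp (θ + π / 2) d₂ := by rw [e1, e2, hcomp]
  have hzero := norm_sq_eq_comp θ (d₁ - d₂)
  have hs : ∀ φ, comp φ (d₁ - d₂) = comp φ d₁ - comp φ d₂ := fun φ => by
    simp only [comp, PiLp.sub_apply]; ring
  rw [hs, hs, hcomp, hcomp', sub_self, sub_self] at hzero
  refine sub_eq_zero.1 (norm_eq_zero.1 (pow_eq_zero_iff two_ne_zero |>.1 ?_))
  linarith

end Coloring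

lemma add_mul_lt_of_mul_neg {α₁ β₁ γ₁ α₂ β₂ γ₂ : ℝ} (h₁ : α₁ + β₁ + γ₁ = 0)
    (h₂ : α₂ + β₂ + γ₂ = 0) (n₁ : α₁ ^ 2 + β₁ ^ 2 + γ₁ ^ 2 = 3 / 2)
    (n₂ : α₂ ^ 2 + β₂ ^ 2 + γ₂ ^ 2 = 3 / 2) (hα : α₁ * α₂ < 0) (hβ : β₁ * β₂ < 0)
    (hpos : 0 < α₁ * β₁) : α₁ * α₂ + β₁ * β₂ + γ₁ * γ₂ < -(3 / 4) := by
  obtain rfl : γ₁ = -α₁ - β₁ := by linarith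
  obtain rfl : γ₂ = -α₂ - β₂ := by linarith
  have n₁' : α₁ ^ 2 + β₁ ^ 2 + α₁ * β₁ = 3 / 4 := by linarith
  have n₂' : α₂ ^ 2 + β₂ ^ 2 + α₂ * β₂ = 3 / 4 := by linarith
  have main : ∀ a b p q : ℝ, 0 < a → 0 < b → 0 < p → 0 < q →
      a ^ 2 + b ^ 2 + a * b = 3 / 4 → p ^ 2 + q ^ 2 + p * q = 3 / 4 →
      3 / 4 < 2 * (a * p) + 2 * (b * q) + a * q + b * p := by
    intro a b p q ha hb hp hq h1 h2
    refine lt_of_pow_lt_pow_left₀ 2 (by positivity) ?_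
    have : (3 / 4 : ℝ) ^ 2 = (a ^ 2 + b ^ 2 + a * b) * (p ^ 2 + q ^ 2 + p * q) := by
      rw [h1, h2]; norm_num
    rw [this]
    have : 0 < (2 * (a * p) + 2 * (b * q) + a * q + b * p) ^ 2 -
        (a ^ 2 + b ^ 2 + a * b) * (p ^ 2 + q ^ 2 + p * q) := by
      ring_nf
      positivity
    linarith
  rcases pos_and_pos_or_neg_and_neg_of_mul_pos hpos with ⟨ha, hb⟩ | ⟨ha, hb⟩
  · have ha' : α₂ < 0 := by
      by_contra hh
      nlinarith
    have hb' : β₂ < 0 := by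
      by_contra hh
      nlinarith
    have := main α₁ β₁ (-α₂) (-β₂) ha hb (by linarith) (by linarith) n₁' (by linarith)
    linarith
  · have ha' : 0 < α₂ := by
      by_contra hh
      nlinarith
    have hb' : 0 < β₂ := by
      by_contra hh
      nlinarith
    have := main (-α₁) (-β₁) α₂ β₂ (by linarith) (by linarith) ha' hb' (by linarith) n₂'
    linarith

lemma sum_mul_lt_of_mul_neg {α₁ β₁ γ₁ α₂ β₂ γ₂ : ℝ} (h₁ : α₁ + β₁ + γ₁ = 0)
    (h₂ : α₂ + β₂ + γ₂ = 0) (n₁ : α₁ ^ 2 + β₁ ^ 2 + γ₁ ^ 2 = 3 / 2)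
    (n₂ : α₂ ^ 2 + β₂ ^ 2 + γ₂ ^ 2 = 3 / 2) (hα : α₁ * α₂ < 0) (hβ : β₁ * β₂ < 0)
    (hγ : γ₁ * γ₂ < 0) : α₁ * α₂ + β₁ * β₂ + γ₁ * γ₂ < -(3 / 4) := by
  have hα0 : α₁ ≠ 0 := left_ne_zero_of_mul hα.ne
  have hβ0 : β₁ ≠ 0 := left_ne_zero_of_mul hβ.ne
  have hγ0 : γ₁ ≠ 0 := left_ne_zero_of_mul hγ.ne
  rcases lt_or_gt_of_ne (mul_ne_zero hα0 hβ0) with h | h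
  · rcases lt_or_gt_of_ne (mul_ne_zero hβ0 hγ0) with h' | h'
    · have hαγ : 0 < α₁ * γ₁ := by
        have h3 := mul_pos_of_neg_of_neg h h'
        have h4 := mul_self_pos.2 hβ0
        by_contra hh
        nlinarith
      linarith [add_mul_lt_of_mul_neg (α₁ := α₁) (β₁ := γ₁) (γ₁ := β₁) (α₂ := α₂) (β₂ := γ₂)
        (γ₂ := β₂) (by linarith) (by linarith) (by linarith) (by linarith) hα hγ hαγ]
    · linarith [add_mul_lt_of_mul_neg (α₁ := β₁) (β₁ := γ₁) (γ₁ := α₁) (α₂ := β₂) (β₂ := γ₂)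
        (γ₂ := α₂) (by linarith) (by linarith) (by linarith) (by linarith) hβ hγ h']
  · exact add_mul_lt_of_mul_neg h₁ h₂ n₁ n₂ hα hβ h

lemma cos_two_pi_div_three : cos (2 * π / 3) = -(1 / 2) := by
  rw [show 2 * π / 3 = π - π / 3 by ring, cos_pi_sub, cos_pi_div_three]

lemma sin_two_pi_div_three : sin (2 * π / 3) = √3 / 2 := by
  rw [show 2 * π / 3 = π - π / 3 by ring, sin_pi_sub, sin_pi_div_three]

lemma comp_add_two_pi_div_three (θ : ℝ) (d : ℝ²) :
    comp (θ + 2 * π / 3) d = -(1 / 2) * comp θ d + √3 / 2 * comp (θ + π / 2) d := by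
  rw [comp_add_pi_div_two, comp, comp, cos_add, sin_add, cos_two_pi_div_three,
    sin_two_pi_div_three]
  ring

lemma comp_sub_two_pi_div_three (θ : ℝ) (d : ℝ²) :
    comp (θ - 2 * π / 3) d = -(1 / 2) * comp θ d - √3 / 2 * comp (θ + π / 2) d := by
  rw [comp_add_pi_div_two, comp, comp, cos_sub, sin_sub, cos_two_pi_div_three,
    sin_two_pi_div_three]
  ring

lemma inner_eq_comp (θ : ℝ) (d e : ℝ²) :
    inner ℝ d e = comp θ d * comp θ e + comp (θ + π / 2) d * comp (θ + π / 2) e := by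
  rw [comp_add_pi_div_two, comp_add_pi_div_two, PiLp.inner_apply]
  simp only [Fin.sum_univ_two, comp, RCLike.inner_apply, conj_trivial]
  linear_combination (-(d 0) * e 0 - d 1 * e 1) * sin_sq_add_cos_sq θ

/-- Unit vectors at angle at most `2π/3` lie on the same side of one of three lines through the
origin enclosing angles `π/3`, unless one of them lies on one of these lines. -/
lemma exists_comp_mul_comp_pos {θ : ℝ} {d₁ d₂ : ℝ²} (hd₁ : ‖d₁‖ = 1) (hd₂ : ‖d₂‖ = 1)
    (hangle : InnerProductGeometry.angle d₁ d₂ ≤ 2 * π / 3)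
    (hne : ∀ φ ∈ ({θ, θ + 2 * π / 3, θ - 2 * π / 3} : Set ℝ), comp φ d₁ * comp φ d₂ ≠ 0) :
    ∃ φ ∈ ({θ, θ + 2 * π / 3, θ - 2 * π / 3} : Set ℝ), 0 < comp φ d₁ * comp φ d₂ := by
  by_contra! hno
  have hneg := fun φ hφ => (hno φ hφ).lt_of_ne (hne φ hφ)
  have hsq : √3 ^ 2 = 3 := sq_sqrt (by norm_num)
  have hinner : -(1 / 2) ≤ inner ℝ d₁ d₂ := by
    rw [← cos_two_pi_div_three, InnerProductGeometry.inner_eq_cos_angle_of_norm_eq_one hd₁ hd₂]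
    exact cos_le_cos_of_nonneg_of_le_pi (InnerProductGeometry.angle_nonneg _ _)
      (by linarith [pi_pos]) hangle
  have n₁ := norm_sq_eq_comp θ d₁
  have n₂ := norm_sq_eq_comp θ d₂
  rw [hd₁] at n₁
  rw [hd₂] at n₂
  have key := sum_mul_lt_of_mul_neg (α₁ := comp θ d₁) (α₂ := comp θ d₂)
    (β₁ := comp (θ + 2 * π / 3) d₁) (β₂ := comp (θ + 2 * π / 3) d₂)
    (γ₁ := comp (θ - 2 * π / 3) d₁) (γ₂ := comp (θ - 2 * π / 3) d₂)
    (by rw [comp_add_two_pi_div_three, comp_sub_two_pi_div_three]; ring)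
    (by rw [comp_add_two_pi_div_three, comp_sub_two_pi_div_three]; ring)
    (by
      rw [comp_add_two_pi_div_three, comp_sub_two_pi_div_three]
      linear_combination (-3 / 2) * n₁ + comp (θ + π / 2) d₁ ^ 2 / 2 * hsq)
    (by
      rw [comp_add_two_pi_div_three, comp_sub_two_pi_div_three]
      linear_combination (-3 / 2) * n₂ + comp (θ + π / 2) d₂ ^ 2 / 2 * hsq)
    (hneg _ (by simp)) (hneg _ (by simp)) (hneg _ (by simp))
  rw [inner_eq_comp θ] at hinner
  simp only [comp_add_two_pi_div_three, comp_sub_two_pi_div_three] at key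
  have : comp (θ + π / 2) d₁ * comp (θ + π / 2) d₂ * √3 ^ 2 =
    comp (θ + π / 2) d₁ * comp (θ + π / 2) d₂ * 3 := by rw [hsq]
  linarith

end

noncomputable section

open Real

theorem stmt17 (B : Set (EuclideanSpace ℝ (Fin 2))) (S : Set (Set (EuclideanSpace ℝ (Fin 2))))
    (hpoly : IsPolygonal B S) (hC3 : C3 B)
    (u₁ u₂ : Set (EuclideanSpace ℝ (Fin 2))) (hu₁ : u₁ ∈ S) (hu₂ : u₂ ∈ S) (hne : u₁ ≠ u₂)
    (X : EuclideanSpace ℝ (Fin 2)) (hX₁ : IsEndpoint X u₁) (hX₂ : IsEndpoint X u₂)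
    (d₁ d₂ : EuclideanSpace ℝ (Fin 2)) (hd₁ : ‖d₁‖ = 1) (hd₂ : ‖d₂‖ = 1)
    (hdir₁ : ∃ ε : ℝ, 0 < ε ∧ ∀ t : ℝ, 0 < t → t < ε → X + t • d₁ ∈ u₁)
    (hdir₂ : ∃ ε : ℝ, 0 < ε ∧ ∀ t : ℝ, 0 < t → t < ε → X + t • d₂ ∈ u₂) :
    InnerProductGeometry.angle d₁ d₂ > 2 * π / 3 := by
  by_contra hangle
  rw [gt_iff_lt, not_lt] at hangle
  have hfr : ∀ u ∈ S, u ⊆ frontier B := fun u hu => hpoly.boundary ▸ Set.subset_sUnion_of_mem hu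
  have hX : X ∈ frontier B := hfr u₁ hu₁ hX₁.1
  have hev : ∀ {u : Set (EuclideanSpace ℝ (Fin 2))} {d : EuclideanSpace ℝ (Fin 2)}, u ∈ S →
      (∃ ε : ℝ, 0 < ε ∧ ∀ t : ℝ, 0 < t → t < ε → X + t • d ∈ u) →
      ∀ᶠ t in nhdsWithin (0 : ℝ) (Set.Ioi 0), X + t • d ∈ frontier B :=
    fun hu ⟨ε, hε, h⟩ => by
      filter_upwards [Ioo_mem_nhdsGT hε] with t ht
      exact hfr _ hu (h t ht.1 ht.2)
  have hd : d₁ ≠ d₂ := by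
    rintro rfl
    obtain ⟨ε₁, hε₁, h₁⟩ := hdir₁
    obtain ⟨ε₂, hε₂, h₂⟩ := hdir₂
    have hpos : 0 < min ε₁ ε₂ / 2 := by positivity
    have hlt : min ε₁ ε₂ / 2 < min ε₁ ε₂ := half_lt_self (by positivity)
    have heq := hpoly.inter_subsingleton u₁ hu₁ u₂ hu₂ hne
      ⟨h₁ _ hpos (hlt.trans_le (min_le_left _ _)), h₂ _ hpos (hlt.trans_le (min_le_right _ _))⟩
      ⟨hX₁.1, hX₂.1⟩
    rcases smul_eq_zero.1 (add_eq_left.1 heq) with h0 | h0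
    · exact hpos.ne' h0
    · simp [h0] at hd₁
  obtain ⟨θ₀, hθ₀⟩ := exists_isColorChange hpoly hC3 hX
  have hstep : ∀ k : ℕ, IsColorChange B X (θ₀ + k * (π / 3)) := fun k => by
    induction k with
    | zero => simpa using hθ₀
    | succ k ih =>
      convert ih.add_pi_div_three hpoly hC3 hX using 1
      push_cast
      ring
  set θ := θ₀ + 2 * π / 3 with hθ
  have hchange : ∀ φ ∈ ({θ, θ + 2 * π / 3, θ - 2 * π / 3} : Set ℝ),
      IsColorChange B X φ ∧ IsColorChange B X (φ + π) ∧ IsColorChange B X (φ + π + π) := by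
    have hk : ∀ (k : ℕ) (φ : ℝ), φ = θ₀ + k * (π / 3) →
        IsColorChange B X φ ∧ IsColorChange B X (φ + π) ∧ IsColorChange B X (φ + π + π) := by
      rintro k φ rfl
      refine ⟨hstep k, ?_, ?_⟩
      · convert hstep (k + 3) using 1
        push_cast
        ring
      · convert hstep (k + 6) using 1
        push_cast
        ring
    rintro φ (rfl | rfl | rfl)
    · exact hk 2 _ (by push_cast; ring)
    · exact hk 4 _ (by push_cast; ring)
    · exact hk 0 _ (by push_cast; ring)
  obtain ⟨φ, hφ, hpos⟩ := exists_comp_mul_comp_pos hd₁ hd₂ hangle (θ := θ) fun φ hφ =>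
    mul_ne_zero
      (comp_ne_zero_of_isColorChange hpoly hC3 hX (hchange φ hφ).1 (hchange φ hφ).2.1 hd₁
        (hev hu₁ hdir₁))
      (comp_ne_zero_of_isColorChange hpoly hC3 hX (hchange φ hφ).1 (hchange φ hφ).2.1 hd₂
        (hev hu₂ hdir₂))
  refine hd ?_
  rcases pos_and_pos_or_neg_and_neg_of_mul_pos hpos with ⟨h1, h2⟩ | ⟨h1, h2⟩
  · exact eq_of_comp_pos_of_comp_pos hpoly hC3 (hchange φ hφ).2.1 hd₁ hd₂ (hev hu₁ hdir₁)
      (hev hu₂ hdir₂) h1 h2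
  · exact eq_of_comp_pos_of_comp_pos hpoly hC3 (hchange φ hφ).2.2 hd₁ hd₂ (hev hu₁ hdir₁)
      (hev hu₂ hdir₂) (by rw [comp_add_pi]; linarith) (by rw [comp_add_pi]; linarith)

end
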